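/- arXiv:1712.06309 — 5 statements merged into one kernel-verified Lean document; each statement's English description precedes it below -/
import Mathlib

section
/- Let H be an integer d×n matrix of rank n with d = n + m, whose top n×n block H_B is lower triangular with positive diagonal entries satisfying 0 ≤ H_{i j} < H_{i i} for all 1 ≤ j < i ≤ n, whose first s diagonal entries equal 1 and whose remaining k = n − s diagonal entries are at least 2 (Hermite-normal-form shape (1)). Let δ = det H_B, let Δ = Δ_n(H) be the maximum absolute value of n×n minors of H, and let H_N be the submatrix formed by the last m rows of H. Then every entry of H_N has absolute value at most (Δ/δ)·(δ/2^{k−1} + k − 1) ≤ Δ; consequently every entry of H has absolute value at most Δ. -/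
open Matrix

/-- `maxAbsSubdet k H` is `Δ_k(H)`: the maximum absolute value of the determinants of
all `k × k` submatrices of `H` (selections with repeated rows or columns contribute `0`,
so this equals the maximum over genuine `k × k` submatrices). -/
def maxAbsSubdet {d n : ℕ} (k : ℕ) (H : Matrix (Fin d) (Fin n) ℤ) : ℕ :=
  Finset.univ.sup fun p : (Fin k → Fin d) × (Fin k → Fin n) =>
    (H.submatrix p.1 p.2).det.natAbs

/-- If `h` is a row vector and `A` a square integer matrix, each coordinate of `h` scaled by `|det A|`
is controlled by the determinants obtained from `A` by replacing one row with `h`. -/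
theorem abs_det_mul_le_of_updateRow {n : ℕ} (A : Matrix (Fin n) (Fin n) ℤ) (h : Fin n → ℤ) {D : ℤ}
    (hD : ∀ i, |(A.updateRow i h).det| ≤ D) (j : Fin n) :
    |A.det * h j| ≤ D * ∑ i, |A i j| := by
  have e : A.det * h j = ∑ i, A i j * (A.updateRow i h).det := by
    have := congrFun (Matrix.mulVec_cramer Aᵀ h) j
    simpa [Matrix.mulVec, dotProduct, Matrix.cramer_transpose_apply] using this.symm
  rw [e, Finset.mul_sum]
  refine (Finset.abs_sum_le_sum_abs _ _).trans (Finset.sum_le_sum fun i _ => ?_)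
  rw [abs_mul, mul_comm]
  exact mul_le_mul_of_nonneg_right (hD i) (abs_nonneg _)

theorem abs_det_submatrix_le_maxAbsSubdet {d n k : ℕ} (H : Matrix (Fin d) (Fin n) ℤ)
    (f : Fin k → Fin d) (g : Fin k → Fin n) :
    |(H.submatrix f g).det| ≤ (maxAbsSubdet k H : ℤ) := by
  rw [Int.abs_eq_natAbs]
  exact Int.ofNat_le.2 <| Finset.le_sup (f := fun p : (Fin k → Fin d) × (Fin k → Fin n) =>
    (H.submatrix p.1 p.2).det.natAbs) (Finset.mem_univ (f, g))

/-- If all `a i` are at least `1`, then so is their product, and `∑ (a i - 1) ≤ ∏ a i - 1`. -/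
theorem sum_sub_one_le_prod_sub_one {ι : Type*} (S : Finset ι) (a : ι → ℝ)
    (ha : ∀ i ∈ S, 1 ≤ a i) :
    1 ≤ ∏ i ∈ S, a i ∧ ∑ i ∈ S, (a i - 1) ≤ ∏ i ∈ S, a i - 1 := by
  classical
  induction S using Finset.induction_on with
  | empty => simp
  | insert x S hx ih =>
    obtain ⟨h1, h2⟩ := ih fun i hi => ha i (Finset.mem_insert_of_mem hi)
    have hax := ha x (Finset.mem_insert_self x S)
    rw [Finset.prod_insert hx, Finset.sum_insert hx]
    constructor <;> nlinarith

/-- The excess `∑ (b i - 1)` of numbers at least `2` is largest, for a given product,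
when all of them but one are equal to `2`. -/
theorem one_add_sum_sub_one_le {ι : Type*} (S : Finset ι) (b : ι → ℝ) (hb : ∀ i ∈ S, 2 ≤ b i) :
    (2 : ℝ) ^ S.card ≤ ∏ i ∈ S, b i ∧
    1 + ∑ i ∈ S, (b i - 1) ≤ (∏ i ∈ S, b i) / 2 ^ ((S.card : ℤ) - 1) + S.card - 1 := by
  obtain ⟨h1, h2⟩ := sum_sub_one_le_prod_sub_one S (fun i => b i / 2)
    fun i hi => by linarith [hb i hi]
  have hp : (0 : ℝ) < 2 ^ S.card := by positivity
  rw [Finset.prod_div_distrib, Finset.prod_const] at h1 h2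
  refine ⟨(one_le_div hp).1 h1, ?_⟩
  rw [zpow_sub_one₀ two_ne_zero, zpow_natCast]
  have e : ∑ i ∈ S, (b i / 2 - 1) = (∑ i ∈ S, (b i - 1)) / 2 - S.card / 2 := by
    rw [Finset.sum_div]
    simp only [Finset.sum_sub_distrib, Finset.sum_const, sub_div, nsmul_eq_mul, mul_one]
    ring
  rw [e] at h2
  have e2 : (∏ i ∈ S, b i) / (2 ^ S.card * 2⁻¹) = 2 * ((∏ i ∈ S, b i) / 2 ^ S.card) := by
    field_simp
  rw [e2]
  linarith

theorem div_two_zpow_add_sub_one_le {k : ℕ} {x : ℝ} (hx : (2 : ℝ) ^ k ≤ x) (h0 : k = 0 → x = 1) :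
    x / 2 ^ ((k : ℤ) - 1) + k - 1 ≤ x := by
  rcases k with _ | k
  · rw [h0 rfl]
    norm_num
  · have hp : (1 : ℝ) ≤ 2 ^ k := one_le_pow₀ one_le_two
    have hk : (k : ℝ) + 1 ≤ 2 ^ k := by exact_mod_cast Nat.lt_two_pow_self
    have ht : x = x / 2 ^ k * 2 ^ k := by field_simp
    have h2 : 2 ≤ x / 2 ^ k := by
      rw [le_div_iff₀ (by positivity)]
      linarith [pow_succ (2 : ℝ) k]
    push_cast
    rw [add_sub_cancel_right, zpow_natCast]
    nlinarith

/-- Let `H` be an integer `(n+m) × n` matrix of rank `n` whose top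
`n × n` block `H_B` is in Hermite-normal-form shape (1): lower triangular, positive
diagonal, `0 ≤ H i j < H i i` for `j < i`, the first `s` diagonal entries equal to `1`
and the remaining `k = n - s` diagonal entries at least `2`.  Let `δ = det H_B` and
`Δ = Δ_n(H)`.  Then every entry of the bottom block `H_N` has absolute value at most
`(Δ/δ) * (δ / 2^(k-1) + k - 1) ≤ Δ`; consequently every entry of `H` has absolute
value at most `Δ`. -/
theorem abs_entries_le_of_HNF (n m s : ℕ) (hs : s ≤ n)
    (H : Matrix (Fin (n + m)) (Fin n) ℤ) (hrank : H.rank = n)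
    (HB : Matrix (Fin n) (Fin n) ℤ) (hHB : HB = H.submatrix (Fin.castAdd m) id)
    (htri : ∀ i j : Fin n, i < j → HB i j = 0)
    (hpos : ∀ i : Fin n, 0 < HB i i)
    (hred : ∀ i j : Fin n, j < i → 0 ≤ HB i j ∧ HB i j < HB i i)
    (hones : ∀ i : Fin n, (i : ℕ) < s → HB i i = 1)
    (htwo : ∀ i : Fin n, s ≤ (i : ℕ) → 2 ≤ HB i i)
    (k : ℕ) (hk : k = n - s)
    (δ : ℤ) (hδ : δ = HB.det)
    (Δ : ℕ) (hΔ : Δ = maxAbsSubdet n H) :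
    (∀ (i : Fin m) (j : Fin n),
        (|H (Fin.natAdd n i) j| : ℝ) ≤
          ((Δ : ℝ) / (δ : ℝ)) * ((δ : ℝ) / 2 ^ ((k : ℤ) - 1) + (k : ℝ) - 1)) ∧
      ((Δ : ℝ) / (δ : ℝ)) * ((δ : ℝ) / 2 ^ ((k : ℤ) - 1) + (k : ℝ) - 1) ≤ (Δ : ℝ) ∧
      (∀ (i : Fin (n + m)) (j : Fin n), |H i j| ≤ (Δ : ℤ)) := by
  have hdet : δ = ∏ i, HB i i := by
    rw [hδ]
    exact Matrix.det_of_isLowerTriangular HB fun i j hij => htri i j hij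
  have hone_le : ∀ i, 1 ≤ HB i i := fun i => hpos i
  have hδpos : 0 < δ := hdet ▸ Finset.prod_pos fun i _ => hpos i
  have hδΔ : δ ≤ Δ := by
    rw [hδ, hHB, hΔ]
    exact (le_abs_self _).trans (abs_det_submatrix_le_maxAbsSubdet _ _ _)
  have hδR : (0 : ℝ) < δ := by exact_mod_cast hδpos
  set S : Finset (Fin n) := Finset.univ.filter fun i => s ≤ (i : ℕ) with hS
  have hcard : S.card = k := by
    have h := Finset.card_filter_add_card_filter_not (s := (Finset.univ : Finset (Fin n)))
      (fun i : Fin n => (i : ℕ) < s)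
    simp only [not_lt, Finset.card_univ, Fintype.card_fin] at h
    have h' : (Finset.univ.filter fun i : Fin n => (i : ℕ) < s).card = s := by
      rw [Fin.card_filter_val_lt, min_eq_right hs]
    rw [h'] at h
    rw [hS, hk]
    omega
  have hprod : ∏ i ∈ S, (HB i i : ℝ) = δ := by
    rw [hdet, Int.cast_prod]
    refine Finset.prod_subset (Finset.subset_univ _) fun i _ hi => ?_
    rw [hones i (by simpa [hS] using hi), Int.cast_one]
  obtain ⟨hpow, hsum⟩ := one_add_sum_sub_one_le S (fun i => (HB i i : ℝ)) fun i hi => by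
    exact_mod_cast htwo i (by simpa [hS] using hi)
  rw [hcard, hprod] at hpow hsum
  have hsumS : ∑ i ∈ S, ((HB i i : ℝ) - 1) = ∑ i, ((HB i i : ℝ) - 1) := by
    refine Finset.sum_subset (Finset.subset_univ _) fun i _ hi => ?_
    rw [hones i (by simpa [hS] using hi), Int.cast_one, sub_self]
  have hcol : ∀ j, ∑ i, |HB i j| ≤ 1 + ∑ i, (HB i i - 1) := fun j => by
    have : ∀ i, |HB i j| ≤ (if i = j then 1 else 0) + (HB i i - 1) := fun i => by
      rcases lt_trichotomy i j with h | rfl | h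
      · simpa [htri i j h, h.ne] using hone_le i
      · simp [abs_of_pos (hpos i)]
      · rw [if_neg h.ne', abs_of_nonneg (hred i j h).1]
        linarith [(hred i j h).2]
    refine (Finset.sum_le_sum fun i _ => this i).trans_eq ?_
    rw [Finset.sum_add_distrib]
    simp
  have hΔδ : (0 : ℝ) ≤ Δ / δ := by positivity
  have hbound : ∀ (i : Fin m) (j : Fin n), (|H (Fin.natAdd n i) j| : ℝ) ≤
      ((Δ : ℝ) / (δ : ℝ)) * ((δ : ℝ) / 2 ^ ((k : ℤ) - 1) + (k : ℝ) - 1) := fun i j => by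
    have h1 := abs_det_mul_le_of_updateRow HB (H (Fin.natAdd n i)) (D := Δ) (fun r => by
      have : HB.updateRow r (H (Fin.natAdd n i)) =
          H.submatrix (Function.update (Fin.castAdd m) r (Fin.natAdd n i)) id := by
        ext a b
        rcases eq_or_ne a r with rfl | h
        · simp
        · simp [hHB, h]
      rw [this, hΔ]
      exact abs_det_submatrix_le_maxAbsSubdet _ _ _) j
    rw [← hδ, abs_mul, abs_of_pos hδpos] at h1
    have h2 : (δ * |H (Fin.natAdd n i) j| : ℤ) ≤ Δ * (1 + ∑ i, (HB i i - 1)) :=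
      h1.trans (mul_le_mul_of_nonneg_left (hcol j) (Int.natCast_nonneg _))
    have h3 : (δ : ℝ) * |(H (Fin.natAdd n i) j : ℝ)| ≤ Δ * (1 + ∑ i, ((HB i i : ℝ) - 1)) := by
      exact_mod_cast h2
    rw [← hsumS] at h3
    calc |(H (Fin.natAdd n i) j : ℝ)| ≤ Δ / δ * (1 + ∑ i ∈ S, ((HB i i : ℝ) - 1)) := by
          rw [div_mul_eq_mul_div, le_div_iff₀ hδR]
          linarith
      _ ≤ _ := mul_le_mul_of_nonneg_left hsum hΔδ
  have hle : ((Δ : ℝ) / (δ : ℝ)) * ((δ : ℝ) / 2 ^ ((k : ℤ) - 1) + (k : ℝ) - 1) ≤ (Δ : ℝ) := by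
    refine (mul_le_mul_of_nonneg_left (div_two_zpow_add_sub_one_le hpow fun h0 => ?_)
      hΔδ).trans_eq (div_mul_cancel₀ _ hδR.ne')
    rw [← hprod, Finset.card_eq_zero.1 (hcard.trans h0), Finset.prod_empty]
  refine ⟨hbound, hle, fun i j => ?_⟩
  induction i using Fin.addCases with
  | left i =>
    have hij : |HB i j| ≤ HB i i := by
      rcases lt_trichotomy i j with h | rfl | h
      · simpa [htri i j h] using (hpos i).le
      · exact (abs_of_pos (hpos i)).le
      · rw [abs_of_nonneg (hred i j h).1]
        exact (hred i j h).2.le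
    have hiδ : HB i i ≤ δ := by
      rw [hdet]
      exact Int.le_of_dvd (hdet ▸ hδpos) (Finset.dvd_prod_of_mem _ (Finset.mem_univ i))
    rw [hHB] at hij
    exact (hij.trans (hHB ▸ hiδ)).trans hδΔ
  | right i => exact_mod_cast (hbound i j).trans hle
end

section
/- Let H be an integer d×n matrix of rank n in the form (1) (top n×n block lower triangular HNF with the unit diagonal entries placed first) such that every n×n submatrix of H is nonsingular, and let Δ = Δ_n(H). If n > Δ·(2Δ + 1)² + log₂ Δ, then H has at most n + 1 rows, i.e. d ≤ n + 1. -/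
open Matrix

theorem natAbs_det_submatrix_le_maxAbsSubdet {d n : ℕ} (H : Matrix (Fin d) (Fin n) ℤ)
    (f : Fin n → Fin d) : (H.submatrix f id).det.natAbs ≤ maxAbsSubdet n H :=
  Finset.le_sup (f := fun p : (Fin n → Fin d) × (Fin n → Fin n) =>
    (H.submatrix p.1 p.2).det.natAbs) (Finset.mem_univ (f, id))

theorem cramer_transpose_submatrix_apply {d n : ℕ} (H : Matrix (Fin d) (Fin n) ℤ)
    (e : Fin n → Fin d) (r : Fin d) (i : Fin n) :
    cramer (H.submatrix e id)ᵀ (H r) i = (H.submatrix (Function.update e i r) id).det := by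
  rw [cramer_transpose_apply]
  congr 1
  ext a b
  by_cases h : a = i
  · subst h; simp
  · simp [h]

/-- If two rows `b`, `c` have equal Cramer coordinates at two positions `i ≠ j` of a row
basis, then exchanging the rows `i`, `j` of the basis for `b`, `c` gives a singular matrix. -/
theorem det_submatrix_update_update_eq_zero {d n : ℕ} (H : Matrix (Fin d) (Fin n) ℤ)
    (e : Fin n → Fin d) (hdet : (H.submatrix e id).det ≠ 0) (b c : Fin d) {i j : Fin n}
    (hij : i ≠ j)
    (hb : cramer (H.submatrix e id)ᵀ (H b) i = cramer (H.submatrix e id)ᵀ (H b) j)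
    (hc : cramer (H.submatrix e id)ᵀ (H c) i = cramer (H.submatrix e id)ᵀ (H c) j) :
    (H.submatrix (Function.update (Function.update e i b) j c) id).det = 0 := by
  set B := H.submatrix e id with hB
  set w : Fin n → ℤ := Pi.single i 1 - Pi.single j 1 with hw
  have hBx : B *ᵥ (B.adjugate *ᵥ w) = B.det • w := by
    rw [mulVec_mulVec, mul_adjugate, smul_mulVec, one_mulVec]
  have hrow : ∀ r, cramer Bᵀ (H r) i = cramer Bᵀ (H r) j → H r ⬝ᵥ (B.adjugate *ᵥ w) = 0 := by
    intro r hr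
    rw [cramer_eq_adjugate_mulVec, ← adjugate_transpose, mulVec_transpose] at hr
    rw [dotProduct_mulVec, hw, dotProduct_sub, dotProduct_single_one, dotProduct_single_one, hr,
      sub_self]
  refine exists_mulVec_eq_zero_iff.mp ⟨B.adjugate *ᵥ w, ?_, ?_⟩
  · intro h0
    rw [h0, mulVec_zero] at hBx
    have := congrFun hBx i
    simp [hw, hij] at this
    exact hdet this.symm
  · ext a
    change H (Function.update (Function.update e i b) j c a) ⬝ᵥ (B.adjugate *ᵥ w) = 0
    by_cases haj : a = j
    · subst haj
      rw [Function.update_self]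
      exact hrow c hc
    · rw [Function.update_of_ne haj]
      by_cases hai : a = i
      · subst hai
        rw [Function.update_self]
        exact hrow b hb
      · rw [Function.update_of_ne hai]
        calc H (e a) ⬝ᵥ (B.adjugate *ᵥ w) = (B.det • w) a := congrFun hBx a
          _ = 0 := by simp [hw, hai, haj]

/-- If no maximal submatrix of `H` is singular and `H` has two rows outside a row basis, then
the number of columns is bounded in terms of the largest subdeterminant. -/
theorem le_sq_of_forall_det_submatrix_ne_zero {d n : ℕ} (H : Matrix (Fin d) (Fin n) ℤ)
    (hH : ∀ f : Fin n → Fin d, Function.Injective f → (H.submatrix f id).det ≠ 0)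
    (e : Fin n → Fin d) (he : Function.Injective e) {b c : Fin d} (hbc : b ≠ c)
    (hb : ∀ i, e i ≠ b) (hc : ∀ i, e i ≠ c) :
    n ≤ (2 * maxAbsSubdet n H + 1) ^ 2 := by
  by_contra! hlt
  set Δ := maxAbsSubdet n H
  let I : Finset ℤ := Finset.Icc (-(Δ : ℤ)) Δ
  let y (r : Fin d) (i : Fin n) : ℤ := cramer (H.submatrix e id)ᵀ (H r) i
  have hy : ∀ r i, y r i ∈ I := by
    intro r i
    have h := natAbs_det_submatrix_le_maxAbsSubdet H (Function.update e i r)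
    rw [← cramer_transpose_submatrix_apply] at h
    change (y r i).natAbs ≤ Δ at h
    rw [Finset.mem_Icc]
    omega
  have hcard : (I ×ˢ I).card < (Finset.univ : Finset (Fin n)).card := by
    have hI : I.card = 2 * Δ + 1 := by
      rw [Int.card_Icc]
      omega
    rw [Finset.card_product, hI, Finset.card_univ, Fintype.card_fin, ← sq]
    exact hlt
  obtain ⟨i, -, j, -, hij, h⟩ := Finset.exists_ne_map_eq_of_card_lt_of_maps_to hcard
    (f := fun i => (y b i, y c i)) fun i _ => Finset.mk_mem_product (hy b i) (hy c i)
  refine hH _ ?_ (det_submatrix_update_update_eq_zero H e (hH e he) b c hij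
    (congrArg Prod.fst h) (congrArg Prod.snd h))
  intro p q hpq
  have := @he p q
  have := hb p
  have := hb q
  have := hc p
  have := hc q
  simp only [Function.update_apply] at hpq
  grind

/-- Let `H` be an integer `d × n` matrix of rank `n` in the
Hermite-normal-form shape (1) (top `n × n` block lower triangular, positive diagonal,
reduced below-diagonal entries, unit diagonal entries placed first) such that every
`n × n` submatrix of `H` is nonsingular, and let `Δ = Δ_n(H)`.
If `n > Δ * (2Δ + 1)² + log₂ Δ`, then `H` has at most `n + 1` rows, i.e. `d ≤ n + 1`. -/
theorem rows_le_succ_of_no_singular_submatrix (d n s : ℕ) (hnd : n ≤ d) (hs : s ≤ n)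
    (H : Matrix (Fin d) (Fin n) ℤ) (hrank : H.rank = n)
    (HB : Matrix (Fin n) (Fin n) ℤ) (hHB : HB = H.submatrix (Fin.castLE hnd) id)
    (htri : ∀ i j : Fin n, i < j → HB i j = 0)
    (hpos : ∀ i : Fin n, 0 < HB i i)
    (hred : ∀ i j : Fin n, j < i → 0 ≤ HB i j ∧ HB i j < HB i i)
    (hones : ∀ i : Fin n, (i : ℕ) < s → HB i i = 1)
    (htwo : ∀ i : Fin n, s ≤ (i : ℕ) → 2 ≤ HB i i)
    (hnonsing : ∀ f : Fin n → Fin d, Function.Injective f →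
      (H.submatrix f id).det ≠ 0)
    (Δ : ℕ) (hΔ : Δ = maxAbsSubdet n H)
    (hn : (n : ℝ) > (Δ : ℝ) * (2 * (Δ : ℝ) + 1) ^ 2 + Real.logb 2 Δ) :
    d ≤ n + 1 := by
  by_contra! hd
  have hinj : Function.Injective (Fin.castLE hnd) := Fin.castLE_injective hnd
  have hle := le_sq_of_forall_det_submatrix_ne_zero H hnonsing (Fin.castLE hnd) hinj
    (b := ⟨n, by omega⟩) (c := ⟨n + 1, by omega⟩) (by simp)
    (fun i h => by have := congrArg Fin.val h; simp at this; omega)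
    (fun i h => by have := congrArg Fin.val h; simp at this; omega)
  have hΔ1 : 1 ≤ Δ := by
    have h := natAbs_det_submatrix_le_maxAbsSubdet H (Fin.castLE hnd)
    have := Int.natAbs_pos.mpr (hnonsing _ hinj)
    omega
  rw [← hΔ] at hle
  have hΔR : (1 : ℝ) ≤ Δ := by exact_mod_cast hΔ1
  have hleR : (n : ℝ) ≤ (2 * (Δ : ℝ) + 1) ^ 2 := by exact_mod_cast hle
  have hlog : 0 ≤ Real.logb 2 Δ := Real.logb_nonneg one_lt_two hΔR
  nlinarith [le_mul_of_one_le_left (sq_nonneg (2 * (Δ : ℝ) + 1)) hΔR]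
end

section
/- Let H be a nonsingular n×n integer matrix in the form (1): lower triangular HNF whose first s diagonal entries equal 1 and whose remaining k = n − s diagonal entries are at least 2, and let Δ = Δ_n(H) = |det H|-bounding maximum absolute n×n minor, i.e. Δ = Δ(H). If n ≥ Δ + log₂ Δ, then the lattice Λ(H) = {H t : t ∈ ℤⁿ} contains a nonzero vector v with ‖v‖_∞ = 1 and at most two nonzero coordinates, each equal to 1 or −1. -/
open Matrix

/-- The lattice generated by the columns of a nonsingular integer matrix has index
`|det H|`. -/
theorem Matrix.natCard_quotient_range_mulVecLin {ι : Type*} [Fintype ι] [DecidableEq ι]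
    {H : Matrix ι ι ℤ} (hdet : H.det ≠ 0) :
    Nat.card ((ι → ℤ) ⧸ LinearMap.range H.mulVecLin) = H.det.natAbs := by
  have hinj : Function.Injective H.mulVecLin := Matrix.mulVec_injective_of_det_ne_zero hdet
  rw [← Submodule.natAbs_det_equiv _ (LinearEquiv.ofInjective H.mulVecLin hinj),
    ← LinearMap.det_toLin' H]
  rfl

/-- If the index of the lattice `Λ(H)` is at most the dimension `n`, then two of the
vectors `0, e₁, …, eₙ` are congruent modulo `Λ(H)`. -/
theorem Matrix.exists_mulVec_eq_single_or_single_sub_single {n : ℕ}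
    {H : Matrix (Fin n) (Fin n) ℤ} (hdet : H.det ≠ 0) (hn : H.det.natAbs ≤ n) :
    ∃ t : Fin n → ℤ, (∃ i, H.mulVec t = Pi.single i 1) ∨
      ∃ i j, i ≠ j ∧ H.mulVec t = Pi.single i 1 - Pi.single j 1 := by
  have hcard := Matrix.natCard_quotient_range_mulVecLin hdet
  have : Finite ((Fin n → ℤ) ⧸ LinearMap.range H.mulVecLin) :=
    Nat.finite_of_card_ne_zero (by rw [hcard]; exact Int.natAbs_ne_zero.mpr hdet)
  let v : Option (Fin n) → Fin n → ℤ := fun o => o.elim 0 fun i => Pi.single i 1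
  have hnot : ¬ Function.Injective fun o => (LinearMap.range H.mulVecLin).mkQ (v o) := by
    intro hinj
    have hle := Nat.card_le_card_of_injective _ hinj
    rw [hcard, Nat.card_eq_fintype_card, Fintype.card_option, Fintype.card_fin] at hle
    omega
  obtain ⟨a, b, hab, hne⟩ := Function.not_injective_iff.mp hnot
  have hmem {a b} (hab : (LinearMap.range H.mulVecLin).mkQ (v a) =
      (LinearMap.range H.mulVecLin).mkQ (v b)) : ∃ t, H.mulVec t = v a - v b :=
    (Submodule.Quotient.eq _).mp hab
  match a, b with
  | none, none => exact absurd rfl hne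
  | some i, none =>
    obtain ⟨t, ht⟩ := hmem hab
    exact ⟨t, .inl ⟨i, by simpa [v] using ht⟩⟩
  | none, some i =>
    obtain ⟨t, ht⟩ := hmem hab.symm
    exact ⟨t, .inl ⟨i, by simpa [v] using ht⟩⟩
  | some i, some j =>
    obtain ⟨t, ht⟩ := hmem hab
    exact ⟨t, .inr ⟨i, j, by simpa using hne, ht⟩⟩

theorem natAbs_det_le_maxAbsSubdet {n : ℕ} (H : Matrix (Fin n) (Fin n) ℤ) :
    H.det.natAbs ≤ maxAbsSubdet n H := by
  simpa [maxAbsSubdet] using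
    Finset.le_sup (f := fun p : (Fin n → Fin n) × (Fin n → Fin n) =>
      (H.submatrix p.1 p.2).det.natAbs) (Finset.mem_univ (id, id))

/-- Let `H` be a nonsingular `n × n` integer matrix in the
Hermite-normal-form shape (1): lower triangular with positive diagonal, reduced
below-diagonal entries, whose first `s` diagonal entries equal `1` and whose remaining
`k = n - s` diagonal entries are at least `2`, and let `Δ = Δ_n(H) (= |det H|)`.
If `n ≥ Δ + log₂ Δ`, then the lattice `Λ(H) = {H t : t ∈ ℤⁿ}` contains a nonzero
vector `v` with `‖v‖_∞ = 1` and at most two nonzero coordinates, each equal to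
`1` or `-1`. -/
theorem exists_short_lattice_vector_square (n s : ℕ) (hs : s ≤ n)
    (H : Matrix (Fin n) (Fin n) ℤ) (hdet : H.det ≠ 0)
    (htri : ∀ i j : Fin n, i < j → H i j = 0)
    (hpos : ∀ i : Fin n, 0 < H i i)
    (hred : ∀ i j : Fin n, j < i → 0 ≤ H i j ∧ H i j < H i i)
    (hones : ∀ i : Fin n, (i : ℕ) < s → H i i = 1)
    (htwo : ∀ i : Fin n, s ≤ (i : ℕ) → 2 ≤ H i i)
    (Δ : ℕ) (hΔ : Δ = maxAbsSubdet n H)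
    (hn : (n : ℝ) ≥ (Δ : ℝ) + Real.logb 2 Δ) :
    ∃ t : Fin n → ℤ, H.mulVec t ≠ 0 ∧
      (∀ a : Fin n, H.mulVec t a = 0 ∨ H.mulVec t a = 1 ∨ H.mulVec t a = -1) ∧
      (Finset.univ.filter fun a : Fin n => H.mulVec t a ≠ 0).card ≤ 2 := by
  have hlog : 0 ≤ Real.logb 2 Δ := by
    rcases Nat.eq_zero_or_pos Δ with h | h
    · simp [h]
    · exact Real.logb_nonneg one_lt_two (by exact_mod_cast h)
  have hΔn : Δ ≤ n := by exact_mod_cast (by linarith : (Δ : ℝ) ≤ n)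
  obtain ⟨t, ⟨i, ht⟩ | ⟨i, j, hij, ht⟩⟩ := Matrix.exists_mulVec_eq_single_or_single_sub_single hdet
    (((natAbs_det_le_maxAbsSubdet H).trans hΔ.ge).trans hΔn)
  · refine ⟨t, ?_, fun a => ?_, ?_⟩
    · simp [ht]
    · by_cases hai : a = i <;> simp [ht, hai]
    · simp [ht, Pi.single_apply, Finset.filter_eq']
  · refine ⟨t, fun h => ?_, fun a => ?_, ?_⟩
    · simpa [h, Pi.single_apply, hij] using congrFun ht i
    · by_cases hai : a = i <;> by_cases haj : a = j <;> simp_all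
    · refine (Finset.card_le_card fun a ha => ?_).trans (Finset.card_le_two (a := i) (b := j))
      by_contra hnot
      simp_all [Pi.single_apply]
end

section
/- Let A be a nonsingular n×n rational matrix with |det A| = Δ > 0 and p ∈ ℚⁿ, and let M = p + parl(A) = {p + A t : t ∈ [0,1)ⁿ}. Suppose A = Q H, where Q is an integer n×n matrix with det Q = ±1 and H is a rational upper triangular n×n matrix with positive diagonal entries H_{1 1}, …, H_{n n}. Then the set M ∩ ℤⁿ is finite and ∏_{i=1}^{n} ⌊H_{i i}⌋ ≤ |M ∩ ℤⁿ| ≤ ∏_{i=1}^{n} ⌈H_{i i}⌉. -/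
open Matrix

theorem Int.card_Ico_ceil_bounds (p h : ℚ) (hh : 0 < h) :
    ⌊h⌋ ≤ ((Finset.Ico ⌈p⌉ ⌈p + h⌉).card : ℤ) ∧
      ((Finset.Ico ⌈p⌉ ⌈p + h⌉).card : ℤ) ≤ ⌈h⌉ := by
  have hle : ⌈p⌉ ≤ ⌈p + h⌉ := Int.ceil_le_ceil (by linarith)
  rw [Int.card_Ico, Int.toNat_of_nonneg (by omega)]
  constructor
  · have h1 : ⌈p⌉ + ⌊h⌋ ≤ ⌈p + h⌉ := by
      rw [← Int.ceil_add_intCast]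
      exact Int.ceil_le_ceil (by linarith [Int.floor_le h])
    omega
  · have h2 := Int.ceil_add_le p h
    omega

/-- The integer points of a translated half-open parallelepiped whose edge matrix is upper
triangular with positive diagonal form a finite set, of cardinality between the product of the
floors and the product of the ceilings of the diagonal entries. -/
theorem exists_finset_int_points_of_upper_triangular (n : ℕ) :
    ∀ (H : Matrix (Fin n) (Fin n) ℚ) (p : Fin n → ℚ), (∀ i j, j < i → H i j = 0) →
      (∀ i, 0 < H i i) →
      ∃ F : Finset (Fin n → ℤ),
        (∀ z, z ∈ F ↔ ∃ t : Fin n → ℚ, (∀ i, 0 ≤ t i ∧ t i < 1) ∧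
          (fun i => (z i : ℚ)) = p + H.mulVec t) ∧
        (∏ i, ⌊H i i⌋) ≤ (F.card : ℤ) ∧ (F.card : ℤ) ≤ ∏ i, ⌈H i i⌉ := by
  induction n with
  | zero =>
    intro H p _ _
    refine ⟨{0}, fun z => ?_, by simp, by simp⟩
    simp only [Finset.mem_singleton, Subsingleton.elim z 0, true_iff]
    exact ⟨0, fun i => i.elim0, Subsingleton.elim _ _⟩
  | succ n ih =>
    intro H p hH hd
    set h := H (Fin.last n) (Fin.last n) with hh
    have hpos : 0 < h := hd _
    choose G hG hlow hupp using fun k : ℤ =>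
      ih (H.submatrix Fin.castSucc Fin.castSucc)
        (fun i => p i.castSucc + H i.castSucc (Fin.last n) * ((k - p (Fin.last n)) / h))
        (fun i j hij => hH _ _ (Fin.castSucc_lt_castSucc_iff.2 hij)) (fun i => hd _)
    let J := Finset.Ico ⌈p (Fin.last n)⌉ ⌈p (Fin.last n) + h⌉
    obtain ⟨hJl, hJu⟩ := Int.card_Ico_ceil_bounds (p (Fin.last n)) h hpos
    let e : (Σ _ : ℤ, Fin n → ℤ) → (Fin (n + 1) → ℤ) :=
      fun x => Fin.snoc (α := fun _ => ℤ) x.2 x.1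
    have he : Function.Injective e := by
      rintro ⟨a, f⟩ ⟨b, g⟩ hab
      obtain ⟨rfl, rfl⟩ := Fin.snoc_injective2 hab
      rfl
    have hcard : (((J.sigma G).image e).card : ℤ) = ∑ k ∈ J, ((G k).card : ℤ) := by
      rw [Finset.card_image_of_injective _ he, Finset.card_sigma, Nat.cast_sum]
    refine ⟨(J.sigma G).image e, fun z => ?_, ?_, ?_⟩
    · have hlast (t : Fin (n + 1) → ℚ) :
          H.mulVec t (Fin.last n) = h * t (Fin.last n) := by
        simp only [mulVec, dotProduct, Fin.sum_univ_castSucc]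
        simp [hH _ _ (Fin.castSucc_lt_last _), hh]
      have hcast (t : Fin (n + 1) → ℚ) (i : Fin n) :
          H.mulVec t i.castSucc =
            (H.submatrix Fin.castSucc Fin.castSucc).mulVec (fun j => t j.castSucc) i +
              H i.castSucc (Fin.last n) * t (Fin.last n) := by
        simp [mulVec, dotProduct, Fin.sum_univ_castSucc]
      simp only [Finset.mem_image, Finset.mem_sigma, Sigma.exists, e, J, Finset.mem_Ico,
        Int.ceil_le, Int.lt_ceil, hG]
      constructor
      · rintro ⟨k, f, ⟨⟨hk1, hk2⟩, t, ht, hft⟩, rfl⟩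
        refine ⟨Fin.snoc (α := fun _ => ℚ) t ((k - p (Fin.last n)) / h), fun i => ?_, ?_⟩
        · refine Fin.lastCases ?_ (fun i => ?_) i
          · rw [Fin.snoc_last]
            exact ⟨div_nonneg (by linarith) hpos.le, (div_lt_one hpos).2 (by linarith)⟩
          · simpa using ht i
        · funext i
          refine Fin.lastCases ?_ (fun i => ?_) i
          · rw [Pi.add_apply, hlast, Fin.snoc_last, Fin.snoc_last]
            field_simp
            ring
          · have := congrFun hft i
            simp only [Pi.add_apply] at this
            rw [Pi.add_apply, hcast]
            simp only [Fin.snoc_castSucc, Fin.snoc_last, this]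
            ring
      · rintro ⟨t, ht, hzt⟩
        have hzl := congrFun hzt (Fin.last n)
        simp only [Pi.add_apply, hlast] at hzl
        have htl : ((z (Fin.last n) : ℚ) - p (Fin.last n)) / h = t (Fin.last n) := by
          rw [hzl]
          field_simp
          ring
        obtain ⟨h0, h1⟩ := ht (Fin.last n)
        refine ⟨z (Fin.last n), fun i => z i.castSucc,
          ⟨⟨by nlinarith, by nlinarith⟩, fun j => t j.castSucc, fun i => ht _, ?_⟩, ?_⟩
        · funext i
          have := congrFun hzt i.castSucc
          simp only [Pi.add_apply, hcast] at this
          simp only [Pi.add_apply, htl, this]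
          ring
        · exact Fin.snoc_init_self z
    · rw [hcard, Fin.prod_univ_castSucc, mul_comm]
      calc _ ≤ (J.card : ℤ) * ∏ i : Fin n, ⌊H i.castSucc i.castSucc⌋ :=
            mul_le_mul_of_nonneg_right hJl
              (Finset.prod_nonneg fun i _ => Int.floor_nonneg.2 (hd _).le)
        _ = ∑ _k ∈ J, ∏ i : Fin n, ⌊H i.castSucc i.castSucc⌋ := by simp
        _ ≤ _ := Finset.sum_le_sum fun k _ => hlow k
    · rw [hcard, Fin.prod_univ_castSucc, mul_comm]
      calc _ ≤ ∑ _k ∈ J, ∏ i : Fin n, ⌈H i.castSucc i.castSucc⌉ :=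
            Finset.sum_le_sum fun k _ => hupp k
        _ = (J.card : ℤ) * ∏ i : Fin n, ⌈H i.castSucc i.castSucc⌉ := by simp
        _ ≤ _ := mul_le_mul_of_nonneg_right hJu
              (Finset.prod_nonneg fun i _ => Int.ceil_nonneg (hd _).le)

/-- Let `A` be a nonsingular `n × n` rational matrix with
`|det A| = Δ > 0` and `p ∈ ℚⁿ`, and let `M = p + parl(A) = {p + A t : t ∈ [0,1)ⁿ}`.
Suppose `A = Q H` where `Q` is an integer matrix with `det Q = ±1` and `H` is a
rational upper triangular matrix with positive diagonal.  Then the set of integer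
points of `M` is finite and
`∏ i, ⌊H i i⌋ ≤ |M ∩ ℤⁿ| ≤ ∏ i, ⌈H i i⌉`. -/
theorem card_int_points_parallelepiped (n : ℕ)
    (A : Matrix (Fin n) (Fin n) ℚ) (p : Fin n → ℚ)
    (Δ : ℚ) (hΔ : Δ = |A.det|) (hΔpos : 0 < Δ)
    (Q : Matrix (Fin n) (Fin n) ℤ) (hQ : Q.det = 1 ∨ Q.det = -1)
    (Hm : Matrix (Fin n) (Fin n) ℚ)
    (hupper : ∀ i j : Fin n, j < i → Hm i j = 0)
    (hdiag : ∀ i : Fin n, 0 < Hm i i)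
    (hfact : A = (Q.map fun z : ℤ => (z : ℚ)) * Hm) :
    let M : Set (Fin n → ℚ) :=
      {x | ∃ t : Fin n → ℚ, (∀ i, 0 ≤ t i ∧ t i < 1) ∧ x = p + A.mulVec t}
    let S : Set (Fin n → ℚ) := {x ∈ M | ∀ i, ∃ z : ℤ, x i = (z : ℚ)}
    S.Finite ∧ (∏ i, ⌊Hm i i⌋) ≤ (Nat.card S : ℤ) ∧
      (Nat.card S : ℤ) ≤ ∏ i, ⌈Hm i i⌉ := by
  intro M S
  have hu : IsUnit Q.det := by
    rcases hQ with h | h <;> simp [h]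
  let q : Matrix (Fin n) (Fin n) ℚ := Q.map fun z : ℤ => (z : ℚ)
  let r : Matrix (Fin n) (Fin n) ℚ := Q⁻¹.map fun z : ℤ => (z : ℚ)
  have hqr : q * r = 1 := by
    change Q.map (Int.castRingHom ℚ) * Q⁻¹.map (Int.castRingHom ℚ) = 1
    rw [← Matrix.map_mul, Q.mul_nonsing_inv hu]
    exact Matrix.map_one _ (map_zero _) (map_one _)
  have hrq : r * q = 1 := mul_eq_one_comm.1 hqr
  have hcast (B : Matrix (Fin n) (Fin n) ℤ) (z : Fin n → ℤ) :
      (fun i => ((B.mulVec z i : ℤ) : ℚ)) =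
        (B.map fun z : ℤ => (z : ℚ)).mulVec fun i => (z i : ℚ) := by
    funext i
    simp [mulVec, dotProduct]
  obtain ⟨F, hF, hlow, hupp⟩ :=
    exists_finset_int_points_of_upper_triangular n Hm (r.mulVec p) hupper hdiag
  let e : (Fin n → ℤ) → (Fin n → ℚ) := fun z => q.mulVec fun i => (z i : ℚ)
  have he : Function.Injective e := by
    intro a b hab
    have := congrArg r.mulVec hab
    simp only [e, mulVec_mulVec, hrq, one_mulVec] at this
    funext i
    exact_mod_cast congrFun this i
  have hS : S = e '' (F : Set (Fin n → ℤ)) := by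
    ext x
    simp only [S, M, Set.mem_ofPred_eq, Set.mem_image, Finset.mem_coe, hF]
    constructor
    · rintro ⟨⟨t, ht, hx⟩, hint⟩
      choose w hw using hint
      have hxw : x = fun i => (w i : ℚ) := funext hw
      refine ⟨Q⁻¹.mulVec w, ⟨t, ht, ?_⟩, ?_⟩
      · rw [hcast, ← hxw, hx, hfact]
        change r.mulVec (p + (q * Hm).mulVec t) = _
        rw [mulVec_add, mulVec_mulVec, ← Matrix.mul_assoc, hrq, Matrix.one_mul]
      · simp only [e]
        rw [hcast, ← hxw]
        change q.mulVec (r.mulVec x) = x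
        rw [mulVec_mulVec, hqr, one_mulVec]
    · rintro ⟨z, ⟨t, ht, hz⟩, rfl⟩
      refine ⟨⟨t, ht, ?_⟩, fun i => ⟨Q.mulVec z i, (congrFun (hcast Q z) i).symm⟩⟩
      simp only [e]
      rw [hz, mulVec_add, mulVec_mulVec, mulVec_mulVec, hqr, one_mulVec, hfact]
  have hcard : Nat.card S = F.card := by
    rw [hS, Nat.card_image_of_injective he]
    simp
  exact ⟨hS ▸ F.finite_toSet.image e, hcard ▸ hlow, hcard ▸ hupp⟩
end

section
/- Let C be a nonsingular n×n integer matrix, A an m×n integer matrix, b ∈ ℤᵐ, c ∈ ℤⁿ, and p ∈ ℚⁿ, and assume cᵀ C ≤ 0 and A C ≥ 0 (both componentwise). Then for every integer point x ∈ ℤⁿ with x ∈ p + cone(C) and A x ≤ b, there exists an integer point y ∈ ℤⁿ with y ∈ p + parl(C), A y ≤ b, and cᵀ y ≥ cᵀ x. In particular, if the feasible set (p + cone(C)) ∩ {x : A x ≤ b} ∩ ℤⁿ is nonempty, then the maximum of cᵀ x over it is attained at a point of p + parl(C). -/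
open Matrix

/-- Let `C` be a nonsingular `n × n` integer matrix, `A` an `m × n`
integer matrix, `b ∈ ℤᵐ`, `c ∈ ℤⁿ`, `p ∈ ℚⁿ`, and assume `cᵀ C ≤ 0` and `A C ≥ 0`
componentwise.  Then for every integer point `x ∈ (p + cone(C))` with `A x ≤ b` there
exists an integer point `y ∈ (p + parl(C))` with `A y ≤ b` and `cᵀ y ≥ cᵀ x`
(so, if feasible, the maximum of `cᵀ x` is attained in `p + parl(C)`). -/
theorem exists_opt_in_parl (n m : ℕ)
    (C : Matrix (Fin n) (Fin n) ℤ) (hC : C.det ≠ 0)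
    (A : Matrix (Fin m) (Fin n) ℤ) (b : Fin m → ℤ) (c : Fin n → ℤ) (p : Fin n → ℚ)
    (hcC : ∀ j : Fin n, ∑ i, c i * C i j ≤ 0)
    (hAC : ∀ (i : Fin m) (j : Fin n), 0 ≤ (A * C) i j) :
    ∀ x : Fin n → ℤ,
      (∃ t : Fin n → ℚ, (∀ i, 0 ≤ t i) ∧
        (fun i => (x i : ℚ)) = p + (C.map fun z : ℤ => (z : ℚ)).mulVec t) →
      (∀ i : Fin m, A.mulVec x i ≤ b i) →
      ∃ y : Fin n → ℤ,
        (∃ t : Fin n → ℚ, (∀ i, 0 ≤ t i ∧ t i < 1) ∧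
          (fun i => (y i : ℚ)) = p + (C.map fun z : ℤ => (z : ℚ)).mulVec t) ∧
        (∀ i : Fin m, A.mulVec y i ≤ b i) ∧
        ∑ i, c i * x i ≤ ∑ i, c i * y i := by
  rintro x ⟨t, ht, hx⟩ hb
  have hk : ∀ j, 0 ≤ ⌊t j⌋ := fun j => Int.floor_nonneg.mpr (ht j)
  refine ⟨x - C *ᵥ fun j => ⌊t j⌋, ⟨fun j => Int.fract (t j),
    fun j => ⟨Int.fract_nonneg _, Int.fract_lt_one _⟩, ?_⟩, fun i => ?_, ?_⟩
  · funext i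
    have hi := congrFun hx i
    simp only [Pi.add_apply, mulVec, dotProduct, map_apply] at hi
    simp only [Pi.add_apply, Pi.sub_apply, mulVec, dotProduct, map_apply, Int.cast_sub,
      Int.cast_sum, Int.cast_mul, Int.fract, mul_sub, Finset.sum_sub_distrib, hi]
    ring
  · have h : 0 ≤ ((A * C) *ᵥ fun j => ⌊t j⌋) i := by
      simp only [mulVec, dotProduct]
      exact Finset.sum_nonneg fun j _ => mul_nonneg (hAC i j) (hk j)
    rw [mulVec_sub, mulVec_mulVec, Pi.sub_apply]
    linarith [hb i]
  · have h : (c ᵥ* C) ⬝ᵥ (fun j => ⌊t j⌋) ≤ 0 :=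
      Finset.sum_nonpos fun j _ => mul_nonpos_of_nonpos_of_nonneg (hcC j) (hk j)
    rw [← dotProduct_mulVec] at h
    change c ⬝ᵥ x ≤ c ⬝ᵥ (x - C *ᵥ fun j => ⌊t j⌋)
    rw [dotProduct_sub]
    linarith
end
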